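/- Let X be a Banach space, Q : X × X × X → X a bounded trilinear map, and a ∈ X. Define the Picard terms A^{(n)} : ℝ → X by A^{(0)}(t) = a and, for n ≥ 1, A^{(n)}(t) = Σ_{n_1+n_2+n_3 = n−1} ∫_0^t Q(A^{(n_1)}(s), A^{(n_2)}(s), A^{(n_3)}(s)) ds. Define, for each full ternary tree T (an element of the inductive type generated by a leaf constructor and a node constructor taking three subtrees), the tree integral 𝒥_T : ℝ → X by 𝒥_{leaf}(t) = a and 𝒥_{node(T_1,T_2,T_3)}(t) = ∫_0^t Q(𝒥_{T_1}(s), 𝒥_{T_2}(s), 𝒥_{T_3}(s)) ds. Then for every n ≥ 0 and every t ∈ ℝ, A^{(n)}(t) = Σ_{T : |T| = n} 𝒥_T(t), where |T| denotes the number of internal (branching) nodes of T and the sum runs over the finitely many full ternary trees of order n. -/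

import Mathlib

open MeasureTheory intervalIntegral

/-- A full ternary tree: every internal node has exactly three ordered children. -/
inductive TernaryTree : Type
  | leaf : TernaryTree
  | node : TernaryTree → TernaryTree → TernaryTree → TernaryTree
deriving DecidableEq

/-- The order of a full ternary tree: its number of internal (branching) nodes. -/
def TernaryTree.order : TernaryTree → ℕ
  | .leaf => 0
  | .node t1 t2 t3 => t1.order + t2.order + t3.order + 1

/-- The tree-indexed iterated Duhamel integral `𝒥_T` associated to a bounded trilinear map
`Q` and initial datum `a`. -/
noncomputable def treeIntegral {X : Type*} [NormedAddCommGroup X] [NormedSpace ℝ X]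
    (Q : X →L[ℝ] X →L[ℝ] X →L[ℝ] X) (a : X) : TernaryTree → ℝ → X
  | .leaf => fun _ => a
  | .node t1 t2 t3 => fun t =>
      ∫ s in (0:ℝ)..t, Q (treeIntegral Q a t1 s) (treeIntegral Q a t2 s)
        (treeIntegral Q a t3 s)

theorem TernaryTree.finite_order_le (n : ℕ) : {T : TernaryTree | T.order ≤ n}.Finite := by
  induction n with
  | zero =>
    refine (Set.finite_singleton TernaryTree.leaf).subset ?_
    intro T hT
    cases T with
    | leaf => rfl
    | node a b c => simp [TernaryTree.order] at hT
  | succ n ih =>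
    refine ((Set.finite_singleton TernaryTree.leaf).union
      ((ih.prod (ih.prod ih)).image (fun q => TernaryTree.node q.1 q.2.1 q.2.2))).subset ?_
    intro T hT
    cases T with
    | leaf => left; rfl
    | node a b c =>
      right
      simp only [TernaryTree.order, Set.mem_ofPred_eq] at hT
      refine ⟨(a, b, c), ⟨?_, ?_, ?_⟩, rfl⟩ <;> simp only [Set.mem_ofPred_eq] <;> omega

theorem TernaryTree.finite_order (n : ℕ) : {T : TernaryTree | T.order = n}.Finite :=
  (TernaryTree.finite_order_le n).subset (fun _ h => le_of_eq h)

theorem treeIntegral_continuous {X : Type*} [NormedAddCommGroup X] [NormedSpace ℝ X]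
    (Q : X →L[ℝ] X →L[ℝ] X →L[ℝ] X) (a : X) (T : TernaryTree) :
    Continuous (treeIntegral Q a T) := by
  induction T with
  | leaf => exact continuous_const
  | node t1 t2 t3 h1 h2 h3 =>
    have : Continuous fun s => Q (treeIntegral Q a t1 s) (treeIntegral Q a t2 s)
        (treeIntegral Q a t3 s) := by fun_prop
    exact intervalIntegral.continuous_primitive (fun _ _ => this.intervalIntegrable _ _) 0

theorem picard_iterate_eq_sum_over_trees
    {X : Type*} [NormedAddCommGroup X] [NormedSpace ℝ X] [CompleteSpace X]
    (Q : X →L[ℝ] X →L[ℝ] X →L[ℝ] X) (a : X)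
    (A : ℕ → ℝ → X)
    (h0 : ∀ t, A 0 t = a)
    (hrec : ∀ (n : ℕ) (t : ℝ), A (n + 1) t =
      ∑ p ∈ Finset.Nat.antidiagonalTuple 3 n,
        ∫ s in (0:ℝ)..t, Q (A (p 0) s) (A (p 1) s) (A (p 2) s)) :
    ∀ n : ℕ, ∃ hfin : {T : TernaryTree | T.order = n}.Finite,
      ∀ t : ℝ, A n t = ∑ T ∈ hfin.toFinset, treeIntegral Q a T t := by
  intro n
  refine ⟨TernaryTree.finite_order n, ?_⟩
  induction n using Nat.strong_induction_on with
  | _ n ih =>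
  intro t
  cases n with
  | zero =>
    have : (TernaryTree.finite_order 0).toFinset = {TernaryTree.leaf} := by
      ext T
      cases T <;> simp [TernaryTree.order]
    rw [this, h0]
    simp [treeIntegral]
  | succ n =>
    let F : ℕ → Finset TernaryTree := fun m => (TernaryTree.finite_order m).toFinset
    have hF : ∀ m T, T ∈ F m ↔ T.order = m := fun m T => by simp [F]
    have key : ∀ p ∈ Finset.Nat.antidiagonalTuple 3 n,
        ∫ s in (0:ℝ)..t, Q (A (p 0) s) (A (p 1) s) (A (p 2) s) =
        ∑ q ∈ F (p 0) ×ˢ F (p 1) ×ˢ F (p 2),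
          treeIntegral Q a (TernaryTree.node q.1 q.2.1 q.2.2) t := by
      intro p hp
      rw [Finset.Nat.mem_antidiagonalTuple, Fin.sum_univ_three] at hp
      simp only [treeIntegral]
      rw [← intervalIntegral.integral_finsetSum]
      · congr 1
        ext s
        rw [ih (p 0) (by omega), ih (p 1) (by omega), ih (p 2) (by omega)]
        rw [Finset.sum_product, map_sum Q, sum_apply, sum_apply]
        refine Finset.sum_congr rfl fun x _ => ?_
        rw [Finset.sum_product, map_sum (Q _), sum_apply]
        refine Finset.sum_congr rfl fun y _ => ?_
        rw [map_sum]
      · intro q _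
        have h1 := treeIntegral_continuous Q a q.1
        have h2 := treeIntegral_continuous Q a q.2.1
        have h3 := treeIntegral_continuous Q a q.2.2
        refine Continuous.intervalIntegrable ?_ _ _
        fun_prop
    rw [hrec, Finset.sum_congr rfl key, Finset.sum_sigma']
    refine Finset.sum_bij (fun x _ => TernaryTree.node x.2.1 x.2.2.1 x.2.2.2) ?_ ?_ ?_ ?_
    · rintro ⟨p, q1, q2, q3⟩ h
      simp only [Finset.mem_sigma, Finset.mem_product, hF, Finset.Nat.mem_antidiagonalTuple,
        Fin.sum_univ_three] at h
      simp only [Set.Finite.mem_toFinset, Set.mem_ofPred_eq, TernaryTree.order]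
      omega
    · rintro ⟨p, q1, q2, q3⟩ h ⟨p', q1', q2', q3'⟩ h' e
      simp only [Finset.mem_sigma, Finset.mem_product, hF] at h h'
      simp only [TernaryTree.node.injEq] at e
      obtain ⟨rfl, rfl, rfl⟩ := e
      have : p = p' := by
        ext i
        fin_cases i
        · exact h.2.1.symm.trans h'.2.1
        · exact h.2.2.1.symm.trans h'.2.2.1
        · exact h.2.2.2.symm.trans h'.2.2.2
      subst this
      rfl
    · intro T hT
      simp only [Set.Finite.mem_toFinset, Set.mem_ofPred_eq] at hT
      cases T with
      | leaf => simp [TernaryTree.order] at hT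
      | node x y z =>
        simp only [TernaryTree.order] at hT
        refine ⟨⟨![x.order, y.order, z.order], (x, y, z)⟩, ?_, rfl⟩
        simp only [Finset.mem_sigma, Finset.mem_product, hF, Finset.Nat.mem_antidiagonalTuple,
          Fin.sum_univ_three]
        refine ⟨?_, rfl, rfl, rfl⟩
        change x.order + y.order + z.order = n
        omega
    · intro x _
      rfl
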